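/- There exists exactly one bounded function v : S × ℝ → ℝ (i.e., there exists M with |v(s,z)| ≤ M for all (s,z)) satisfying T̄ v = v. -/

import Mathlib

/-- The CVaR–Bellman operator:
`T̄ v (s, z) = max_{a ∈ A} [min 0 (r s a + z) - min 0 z
  + γ * Σ_{s'} P(s'|s,a) * v (s', (r s a + z) / γ)]`. -/
noncomputable def cvarBellman {S A : Type*} [Fintype S] [Fintype A] [Nonempty A]
    (P : S → A → PMF S) (r : S → A → ℝ) (γ : ℝ) (v : S × ℝ → ℝ) : S × ℝ → ℝ :=
  fun x => Finset.univ.sup' Finset.univ_nonempty fun a =>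
    min 0 (r x.1 a + x.2) - min 0 x.2
      + γ * ∑ s' : S, ((P x.1 a) s').toReal * v (s', (r x.1 a + x.2) / γ)

/-- A self-map of real functions that contracts uniform distances by a factor `K < 1` and maps the
zero function to a bounded function has exactly one bounded fixed point. -/
theorem existsUnique_bounded_fixedPoint_of_contracting {X : Type*} (T : (X → ℝ) → X → ℝ)
    {K : ℝ} (hK₀ : 0 ≤ K) (hK₁ : K < 1) {B : ℝ} (hB : ∀ x, |T 0 x| ≤ B)
    (hT : ∀ (u v : X → ℝ) (C : ℝ), (∀ x, |u x - v x| ≤ C) → ∀ x, |T u x - T v x| ≤ K * C) :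
    ∃! v : X → ℝ, (∃ M : ℝ, ∀ x, |v x| ≤ M) ∧ T v = v := by
  let _ : TopologicalSpace X := ⊥
  have : DiscreteTopology X := ⟨rfl⟩
  have hbdd (v : BoundedContinuousFunction X ℝ) (x : X) : ‖T v x‖ ≤ B + K * ‖v‖ := by
    have h := hT v 0 ‖v‖ (fun y => by simpa using v.norm_coe_le_norm y) x
    calc ‖T v x‖ = |T 0 x + (T v x - T 0 x)| := by rw [add_sub_cancel, Real.norm_eq_abs]
      _ ≤ |T 0 x| + |T v x - T 0 x| := abs_add_le _ _
      _ ≤ B + K * ‖v‖ := add_le_add (hB x) h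
  let F (v : BoundedContinuousFunction X ℝ) : BoundedContinuousFunction X ℝ :=
    .ofNormedAddCommGroupDiscrete (T v) _ (hbdd v)
  have hF : ContractingWith ⟨K, hK₀⟩ F := by
    refine ⟨hK₁, LipschitzWith.of_dist_le_mul fun u v => ?_⟩
    refine (BoundedContinuousFunction.dist_le (mul_nonneg hK₀ dist_nonneg)).2 fun x => ?_
    exact hT u v (dist u v) (fun y =>
      (Real.dist_eq (u y) (v y)).ge.trans (BoundedContinuousFunction.dist_coe_le_dist y)) x
  let v₀ : BoundedContinuousFunction X ℝ := hF.fixedPoint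
  have hv₀ : F v₀ = v₀ := hF.fixedPoint_isFixedPt
  refine ⟨v₀, ⟨⟨‖v₀‖, v₀.norm_coe_le_norm⟩, congrArg DFunLike.coe hv₀⟩, ?_⟩
  rintro v ⟨⟨M, hM⟩, hv⟩
  let w : BoundedContinuousFunction X ℝ := .ofNormedAddCommGroupDiscrete v M hM
  have hw : Function.IsFixedPt F w := DFunLike.coe_injective hv
  exact congrArg DFunLike.coe (hF.fixedPoint_unique hw)

theorem Finset.abs_sup'_le {ι : Type*} {s : Finset ι} (hs : s.Nonempty) {f : ι → ℝ} {C : ℝ}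
    (h : ∀ i ∈ s, |f i| ≤ C) : |s.sup' hs f| ≤ C := by
  obtain ⟨i, hi, hfi⟩ := s.exists_mem_eq_sup' hs f
  exact hfi ▸ h i hi

theorem Finset.abs_sup'_sub_sup'_le {ι : Type*} {s : Finset ι} (hs : s.Nonempty) {f g : ι → ℝ}
    {C : ℝ} (h : ∀ i ∈ s, |f i - g i| ≤ C) : |s.sup' hs f - s.sup' hs g| ≤ C := by
  rw [abs_sub_le_iff, sub_le_iff_le_add, sub_le_iff_le_add]
  constructor <;> refine Finset.sup'_le hs _ fun i hi => ?_
  · linarith [(abs_sub_le_iff.1 (h i hi)).1, Finset.le_sup' g hi]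
  · linarith [(abs_sub_le_iff.1 (h i hi)).2, Finset.le_sup' f hi]

theorem PMF.sum_toReal_eq_one {S : Type*} [Fintype S] (p : PMF S) : ∑ s, (p s).toReal = 1 := by
  rw [← ENNReal.toReal_sum fun s _ => p.apply_ne_top s, ← tsum_fintype (L := .unconditional S),
    p.tsum_coe, ENNReal.toReal_one]

theorem PMF.abs_sum_toReal_mul_le {S : Type*} [Fintype S] (p : PMF S) {f : S → ℝ} {C : ℝ}
    (h : ∀ s, |f s| ≤ C) : |∑ s, (p s).toReal * f s| ≤ C :=
  calc |∑ s, (p s).toReal * f s| ≤ ∑ s, |(p s).toReal * f s| := Finset.abs_sum_le_sum_abs _ _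
    _ ≤ ∑ s, (p s).toReal * C := Finset.sum_le_sum fun s _ => by
        rw [abs_mul, abs_of_nonneg ENNReal.toReal_nonneg]
        exact mul_le_mul_of_nonneg_left (h s) ENNReal.toReal_nonneg
    _ = C := by rw [← Finset.sum_mul, p.sum_toReal_eq_one, one_mul]

/-- The CVaR–Bellman operator contracts uniform distances by the discount factor. -/
theorem abs_cvarBellman_sub_le {S A : Type*} [Fintype S] [Fintype A] [Nonempty A]
    (P : S → A → PMF S) (r : S → A → ℝ) {γ : ℝ} (hγ : 0 ≤ γ) (u v : S × ℝ → ℝ) (C : ℝ)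
    (h : ∀ x, |u x - v x| ≤ C) (x : S × ℝ) :
    |cvarBellman P r γ u x - cvarBellman P r γ v x| ≤ γ * C := by
  refine Finset.abs_sup'_sub_sup'_le _ fun a _ => ?_
  rw [add_sub_add_left_eq_sub, ← mul_sub, ← Finset.sum_sub_distrib, abs_mul, abs_of_nonneg hγ]
  simp_rw [← mul_sub]
  exact mul_le_mul_of_nonneg_left ((P x.1 a).abs_sum_toReal_mul_le fun s => h _) hγ

theorem abs_cvarBellman_zero_le {S A : Type*} [Fintype S] [Fintype A] [Nonempty A]
    (P : S → A → PMF S) (r : S → A → ℝ) {r_max : ℝ} (hr : ∀ s a, |r s a| ≤ r_max) (γ : ℝ)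
    (x : S × ℝ) : |cvarBellman P r γ 0 x| ≤ r_max := by
  refine Finset.abs_sup'_le _ fun a _ => ?_
  have h := abs_min_sub_min_le_max 0 (r x.1 a + x.2) 0 x.2
  simp only [sub_self, abs_zero, add_sub_cancel_right] at h
  simpa using h.trans (max_le ((abs_nonneg _).trans (hr x.1 a)) (hr x.1 a))

/-- there is exactly one bounded function `v` with `T̄ v = v`. -/
theorem cvarBellman_existsUnique_boundedFixedPoint
    {S A : Type*} [Fintype S] [Nonempty S] [Fintype A] [Nonempty A]
    (P : S → A → PMF S) (r : S → A → ℝ) (r_max : ℝ) (hr_max : 0 < r_max)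
    (hr : ∀ s a, |r s a| ≤ r_max) (γ : ℝ) (hγ : γ ∈ Set.Ioo (0 : ℝ) 1) :
    ∃! v : S × ℝ → ℝ,
      (∃ M : ℝ, ∀ s z, |v (s, z)| ≤ M) ∧ cvarBellman P r γ v = v := by
  obtain ⟨hγ₀, hγ₁⟩ := hγ
  simpa only [Prod.forall] using existsUnique_bounded_fixedPoint_of_contracting
    (cvarBellman P r γ) hγ₀.le hγ₁ (abs_cvarBellman_zero_le P r hr γ)
    (abs_cvarBellman_sub_le P r hγ₀.le)
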